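/- Sparse-case counting bound: Let ρ = (x,y) ∈ ℤ² be a primitive vector and let h ≥ 1 be an integer. Then the number of lattice points (a,b) ∈ ℤ² with max(|a|,|b|) ≤ h and x·b − y·a = 1 is at most 2h/‖ρ‖ + 1, where ‖ρ‖ = max(|x|,|y|). (These are exactly the lattice points τ for which the cone spanned by ρ and τ is smooth with τ counterclockwise from ρ; they lie on a single line parallel to ρ.) -/

import Mathlib

/-- A vector `u ∈ ℤ²` is primitive if it is nonzero and its coordinates are coprime. -/
def Primitive (u : ℤ × ℤ) : Prop := u ≠ 0 ∧ Int.gcd u.1 u.2 = 1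

/-- The sup norm of a lattice vector, as a natural number. -/
def hgt (u : ℤ × ℤ) : ℕ := max u.1.natAbs u.2.natAbs

/-- A finite set that injects into a single residue class modulo `n` inside `[-h, h]` has at
most `2 * h / n + 1` elements. -/
theorem Finset.card_le_of_injOn_of_dvd_sub {ι : Type*} (s : Finset ι) (f : ι → ℤ) {n : ℕ}
    (hn : 0 < n) (h : ℕ) (hf : Set.InjOn f s) (hbound : ∀ i ∈ s, -(h : ℤ) ≤ f i ∧ f i ≤ h)
    (hdvd : ∀ i ∈ s, ∀ j ∈ s, (n : ℤ) ∣ f i - f j) :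
    s.card ≤ 2 * h / n + 1 := by
  have hn' : (0 : ℤ) < n := by exact_mod_cast hn
  have hmaps : Set.MapsTo (fun i => (f i + h) / (n : ℤ)) s
      (Finset.Icc (0 : ℤ) ((2 * h / n : ℕ) : ℤ)) := by
    intro i hi
    obtain ⟨hl, hu⟩ := hbound i hi
    rw [Finset.mem_coe, Finset.mem_Icc]
    refine ⟨Int.ediv_nonneg (by lia) hn'.le, ?_⟩
    push_cast
    exact Int.ediv_le_ediv hn' (by lia)
  have hinj : Set.InjOn (fun i => (f i + h) / (n : ℤ)) s := by
    intro i hi j hj hij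
    refine hf hi hj ?_
    have hmod : (f i + h) % (n : ℤ) = (f j + h) % (n : ℤ) :=
      Int.emod_eq_emod_iff_emod_sub_eq_zero.mpr <| Int.emod_eq_zero_of_dvd <| by
        simpa using hdvd i hi j hj
    have hdiv : (f i + h) / (n : ℤ) = (f j + h) / (n : ℤ) := hij
    have hi' := Int.emod_add_mul_ediv (f i + h) n
    rw [hmod, hdiv, Int.emod_add_mul_ediv] at hi'
    lia
  have hcard := Finset.card_le_card_of_injOn _ hmaps hinj
  rw [Int.card_Icc] at hcard
  lia

/-- Sparse-case counting bound: the number of lattice points `(a, b)` of sup norm at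
most `h` with `x·b − y·a = 1` (those forming a smooth cone with `ρ = (x, y)`,
counterclockwise from it) is at most `2h/‖ρ‖ + 1`. -/
theorem smooth_partner_count (ρ : ℤ × ℤ) (hρ : Primitive ρ) (h : ℕ) (hh : 1 ≤ h) :
    (((Finset.Icc (-(h : ℤ), -(h : ℤ)) ((h : ℤ), (h : ℤ))).filter
        (fun w => ρ.1 * w.2 - ρ.2 * w.1 = 1)).card : ℝ)
      ≤ 2 * (h : ℝ) / (hgt ρ : ℝ) + 1 := by
  obtain ⟨hne, hgcd⟩ := hρ
  obtain ⟨x, y⟩ := ρ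
  have hcop : IsCoprime x y := Int.isCoprime_iff_gcd_eq_one.mpr hgcd
  have hpos : 0 < hgt (x, y) := by
    simp only [ne_eq, Prod.mk_eq_zero] at hne
    simp only [hgt]
    lia
  suffices hcard : ((Finset.Icc (-(h : ℤ), -(h : ℤ)) ((h : ℤ), (h : ℤ))).filter
      (fun w => x * w.2 - y * w.1 = 1)).card ≤ 2 * h / hgt (x, y) + 1 by
    calc _ ≤ ((2 * h / hgt (x, y) + 1 : ℕ) : ℝ) := by exact_mod_cast hcard
      _ ≤ _ := by
        push_cast
        gcongr
        exact_mod_cast Nat.cast_div_le (α := ℝ) (m := 2 * h) (n := hgt (x, y))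
  rcases le_total y.natAbs x.natAbs with hyx | hxy
  · have hgt_eq : hgt (x, y) = x.natAbs := max_eq_left hyx
    rw [hgt_eq] at hpos ⊢
    refine Finset.card_le_of_injOn_of_dvd_sub _ Prod.fst hpos h ?_ ?_ ?_
    · rintro ⟨a, b⟩ hw ⟨a', b'⟩ hw' rfl
      simp only [Finset.coe_filter, Set.mem_ofPred_eq] at hw hw'
      have hb : x * b = x * b' := by linarith [hw.2, hw'.2]
      rw [mul_left_cancel₀ (Int.natAbs_pos.mp hpos) hb]
    · rintro ⟨a, b⟩ hw
      simp only [Finset.mem_filter, Finset.mem_Icc, Prod.mk_le_mk] at hw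
      exact ⟨hw.1.1.1, hw.1.2.1⟩
    · rintro ⟨a, b⟩ hw ⟨a', b'⟩ hw'
      simp only [Finset.mem_filter] at hw hw'
      rw [Int.natAbs_dvd]
      exact hcop.dvd_of_dvd_mul_left ⟨b - b', by linarith [hw.2, hw'.2]⟩
  · have hgt_eq : hgt (x, y) = y.natAbs := max_eq_right hxy
    rw [hgt_eq] at hpos ⊢
    refine Finset.card_le_of_injOn_of_dvd_sub _ Prod.snd hpos h ?_ ?_ ?_
    · rintro ⟨a, b⟩ hw ⟨a', b'⟩ hw' rfl
      simp only [Finset.coe_filter, Set.mem_ofPred_eq] at hw hw'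
      have ha : y * a = y * a' := by linarith [hw.2, hw'.2]
      rw [mul_left_cancel₀ (Int.natAbs_pos.mp hpos) ha]
    · rintro ⟨a, b⟩ hw
      simp only [Finset.mem_filter, Finset.mem_Icc, Prod.mk_le_mk] at hw
      exact ⟨hw.1.1.2, hw.1.2.2⟩
    · rintro ⟨a, b⟩ hw ⟨a', b'⟩ hw'
      simp only [Finset.mem_filter] at hw hw'
      rw [Int.natAbs_dvd]
      exact hcop.symm.dvd_of_dvd_mul_left ⟨a - a', by linarith [hw.2, hw'.2]⟩
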